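/- For every fixed 0 ≤ p < 1, every integer m ≥ 1 and every 0 < θ ≤ m(1-p), the zero-inflated binomial variable is dominated in the convex order by the zero-inflated Poisson variable with the same mean and zero-inflation: X(m,θ,p) ≤cx Y(θ,p). -/

import Mathlib

open MeasureTheory Filter Topology ProbabilityTheory

noncomputable section

/-- `ConvexOrder μ ν` means the distribution `μ` is dominated by `ν` in the convex order:
`∫ φ dμ ≤ ∫ φ dν` for every convex function `φ : ℝ → ℝ` for which both integrals are
well defined. -/
def ConvexOrder (μ ν : Measure ℝ) : Prop :=
  ∀ φ : ℝ → ℝ, ConvexOn ℝ Set.univ φ → Integrable φ μ → Integrable φ ν →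
    ∫ x, φ x ∂μ ≤ ∫ x, φ x ∂ν

/-- The discrete measure on `ℝ` supported on the nonnegative integers with weights `w k`. -/
def discreteMeasure (w : ℕ → ℝ) : Measure ℝ :=
  Measure.sum fun k => ENNReal.ofReal (w k) • Measure.dirac (k : ℝ)

/-- The Poisson probabilities with mean `θ`. -/
def poissonPMFReal (θ : ℝ) (k : ℕ) : ℝ := Real.exp (-θ) * θ ^ k / k.factorial

/-- The Poisson distribution with mean `θ`, as a measure on `ℝ`. -/
def poissonMeasure (θ : ℝ) : Measure ℝ := discreteMeasure (poissonPMFReal θ)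

/-- The binomial probabilities with parameters `m` and `q`. -/
def binomialPMFReal (m : ℕ) (q : ℝ) (k : ℕ) : ℝ :=
  (m.choose k) * q ^ k * (1 - q) ^ (m - k)

/-- The binomial distribution with parameters `m` and `q`, as a measure on `ℝ`. -/
def binomialMeasure (m : ℕ) (q : ℝ) : Measure ℝ := discreteMeasure (binomialPMFReal m q)

/-- The negative binomial probabilities: `P(Z(t,θ) = k) =
(Γ(k + 1/t)/(k! Γ(1/t))) (θt)^k / (1 + θt)^(k + 1/t)`; this distribution has mean `θ`. -/
def negBinomialPMFReal (t θ : ℝ) (k : ℕ) : ℝ :=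
  Real.Gamma (k + 1 / t) / (k.factorial * Real.Gamma (1 / t)) * (θ * t) ^ k /
    (1 + θ * t) ^ ((k : ℝ) + 1 / t)

/-- The negative binomial distribution `Z(t,θ)`, as a measure on `ℝ`. -/
def negBinomialMeasure (t θ : ℝ) : Measure ℝ := discreteMeasure (negBinomialPMFReal t θ)

/-- Zero inflation: the mixture of the point mass at `0` with weight `p` and `μ` with
weight `1 - p`. -/
def ziMeasure (p : ℝ) (μ : Measure ℝ) : Measure ℝ :=
  ENNReal.ofReal p • Measure.dirac (0 : ℝ) + ENNReal.ofReal (1 - p) • μ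

/-- The zero-inflated Poisson distribution `Y(θ,p)`: mixture of the point mass at `0` with
weight `p` and the Poisson distribution with mean `θ/(1-p)` with weight `1-p`. -/
def ZIP (θ p : ℝ) : Measure ℝ := ziMeasure p (poissonMeasure (θ / (1 - p)))

/-- The zero-inflated binomial distribution `X(m,θ,p)`: mixture of the point mass at `0` with
weight `p` and the binomial distribution with parameters `m` and `θ/(m(1-p))` with
weight `1-p`. -/
def ZIB (m : ℕ) (θ p : ℝ) : Measure ℝ :=
  ziMeasure p (binomialMeasure m (θ / (m * (1 - p))))

/-- The zero-inflated negative binomial distribution of the first kind `Z₁(t,θ,p)`: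
mixture of the point mass at `0` with weight `p` and `Z(t(1-p), θ/(1-p))` with weight `1-p`. -/
def ZINB₁ (t θ p : ℝ) : Measure ℝ :=
  ziMeasure p (negBinomialMeasure (t * (1 - p)) (θ / (1 - p)))

/-- The zero-inflated negative binomial distribution of the second kind `Z₂(t,θ,p)`:
mixture of the point mass at `0` with weight `p` and `Z(t, θ/(1-p))` with weight `1-p`. -/
def ZINB₂ (t θ p : ℝ) : Measure ℝ :=
  ziMeasure p (negBinomialMeasure t (θ / (1 - p)))

/-- The probability mass function of the zero-inflated negative binomial
distribution `Z₂(t,θ,p)`. -/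
def zinb2PMFReal (t θ p : ℝ) (k : ℕ) : ℝ :=
  (if k = 0 then p else 0) + (1 - p) * negBinomialPMFReal t (θ / (1 - p)) k

/-- The expected value of the maximum of `k` independent copies of a random variable with
distribution `μ`. -/
def expMax (μ : Measure ℝ) (k : ℕ) : ℝ :=
  ∫ x : Fin k → ℝ, (⨆ i, x i) ∂(Measure.pi fun _ => μ)

/-- The expected value of the minimum of `k` independent copies of a random variable with
distribution `μ`. -/
def expMin (μ : Measure ℝ) (k : ℕ) : ℝ :=
  ∫ x : Fin k → ℝ, (⨅ i, x i) ∂(Measure.pi fun _ => μ)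

/-- The modified Bessel function of the first kind of integer order `n`. -/
def besselI (n : ℕ) (x : ℝ) : ℝ :=
  ∑' j : ℕ, (x / 2) ^ (2 * j + n) / (j.factorial * (j + n).factorial)

/-- `M₂ θ`: the expected value of the maximum of two independent Poisson random variables
with mean `θ`. -/
def M₂ (x : ℝ) : ℝ := x + x * Real.exp (-2 * x) * (besselI 0 (2 * x) + besselI 1 (2 * x))

/-- The discrepancy `Δ₂:₂(θ,p) = 2pθ + (1-p)² M₂(θ/(1-p)) − M₂(θ)`. -/
def Δdisc (θ p : ℝ) : ℝ := 2 * p * θ + (1 - p) ^ 2 * M₂ (θ / (1 - p)) - M₂ θ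

/-- The asymptotic variance `σ²(θ)` of `√n Δ₂:₂` under the Poisson null hypothesis. -/
def σsq (θ : ℝ) : ℝ :=
  θ ^ 2 * (1 - Real.exp (-2 * θ) *
      ((1 + θ) * besselI 0 (2 * θ) - besselI 1 (2 * θ) + θ * besselI 2 (2 * θ))) ^ 2 /
    (Real.exp θ - 1 - θ)

/-- At integer points, a convex function lies below its chord on `[a, b]` and above the chord's
line off the open interval `(a, b)`. -/
lemma ConvexOn.exists_affine_natCast {φ : ℝ → ℝ} (hφ : ConvexOn ℝ Set.univ φ) {a b : ℕ}
    (hab : a < b) :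
    ∃ c d : ℝ, (∀ k : ℕ, a ≤ k → k ≤ b → φ k ≤ c + d * k) ∧
      ∀ k : ℕ, k ≤ a ∨ b ≤ k → c + d * k ≤ φ k := by
  have hab' : (a : ℝ) < b := by exact_mod_cast hab
  have hba : (0 : ℝ) < b - a := sub_pos.2 hab'
  have three : ∀ x y z : ℝ, x < y → y < z →
      (z - x) * φ y ≤ (z - y) * φ x + (y - x) * φ z := by
    intro x y z hxy hyz
    have h := hφ.slope_mono_adjacent (Set.mem_univ x) (Set.mem_univ z) hxy hyz
    rw [div_le_div_iff₀ (by linarith) (by linarith)] at h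
    linarith
  have key : ∀ k : ℝ, φ a - (φ b - φ a) / (b - a) * a + (φ b - φ a) / (b - a) * k
      = ((b - k) * φ a + (k - a) * φ b) / (b - a) := by
    intro k
    field_simp
    ring
  refine ⟨φ a - (φ b - φ a) / (b - a) * a, (φ b - φ a) / (b - a), ?_, ?_⟩
  · intro k h₁ h₂
    rw [key, le_div_iff₀ hba]
    rcases h₁.eq_or_lt with rfl | h₁
    · linarith
    rcases h₂.eq_or_lt with rfl | h₂
    · linarith
    linarith [three a k b (by exact_mod_cast h₁) (by exact_mod_cast h₂)]
  · intro k h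
    rw [key, div_le_iff₀ hba]
    rcases h with h | h
    · rcases h.eq_or_lt with rfl | h
      · linarith
      linarith [three k a b (by exact_mod_cast h) hab']
    · rcases h.eq_or_lt with rfl | h
      · linarith
      linarith [three a b k hab' (by exact_mod_cast h)]

/-- If a sequence `u`, eventually at most `1`, increases up to `N` and decreases afterwards, then
for any convex function `φ` some affine function lies above `φ` where `1 < u` and below `φ` where
`u < 1`. -/
lemma ConvexOn.exists_affine_of_unimodal {φ : ℝ → ℝ} (hφ : ConvexOn ℝ Set.univ φ) {u : ℕ → ℝ}
    {N M : ℕ} (hinc : ∀ k < N, u k ≤ u (k + 1)) (hdec : ∀ k, N ≤ k → u (k + 1) ≤ u k)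
    (hM : ∀ k, M < k → u k ≤ 1) :
    ∃ c d : ℝ, ∀ k : ℕ, 0 ≤ (φ k - (c + d * k)) * (1 - u k) := by
  have hmono : ∀ i j, i ≤ j → j ≤ N → u i ≤ u j := by
    intro i j hij
    induction j, hij using Nat.le_induction with
    | base => intro _; exact le_rfl
    | succ j _ ih => intro hj; exact (ih (by lia)).trans (hinc j (by lia))
  have hanti : ∀ i j, i ≤ j → N ≤ i → u j ≤ u i := by
    intro i j hij hi
    induction j, hij using Nat.le_induction with
    | base => exact le_rfl
    | succ j hj ih => exact (hdec j (by lia)).trans ih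
  have hconn : ∀ i j k, i ≤ j → j ≤ k → 1 < u i → 1 < u k → 1 < u j := by
    intro i j k hij hjk hi hk
    rcases le_total j N with h | h
    · exact hi.trans_le (hmono i j hij h)
    · exact hk.trans_le (hanti j k hjk h)
  obtain ⟨a, b, hab, hout, hin⟩ : ∃ a b : ℕ, a < b ∧
      (∀ k, k < a ∨ b < k → u k ≤ 1) ∧ ∀ k, a < k → k < b → 1 < u k := by
    classical
    by_cases hne : ∃ k, 1 < u k
    · have hmem : ∀ k, 1 < u k → k ≤ M := fun k hk => by
        by_contra! h
        exact absurd hk (hM k h).not_gt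
      obtain ⟨k₀, hk₀⟩ := hne
      have hne : ∃ k, 1 < u k := ⟨k₀, hk₀⟩
      set a := Nat.find hne
      set b := Nat.findGreatest (fun k => 1 < u k) M
      have ha : 1 < u a := Nat.find_spec hne
      have hb : 1 < u b := Nat.findGreatest_spec (P := fun k => 1 < u k) (hmem k₀ hk₀) hk₀
      refine ⟨a, max b (a + 1), by simp, ?_, ?_⟩
      · rintro k (h | h)
        · exact not_lt.1 (Nat.find_min hne h)
        · by_contra! hk
          have := Nat.le_findGreatest (P := fun k => 1 < u k) (hmem k hk) hk
          lia
      · intro k h₁ h₂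
        exact hconn a k b h₁.le (by lia) ha hb
    · push Not at hne
      exact ⟨0, 1, one_pos, fun k _ => hne k, fun k _ _ => by lia⟩
  obtain ⟨c, d, hle, hge⟩ := hφ.exists_affine_natCast hab
  refine ⟨c, d, fun k => ?_⟩
  rcases lt_trichotomy k a with h | rfl | h
  · exact mul_nonneg (sub_nonneg.2 (hge k (.inl h.le))) (sub_nonneg.2 (hout k (.inl h)))
  · rw [le_antisymm (hle k le_rfl hab.le) (hge k (.inl le_rfl)), sub_self, zero_mul]
  rcases lt_trichotomy k b with h' | rfl | h'
  · exact mul_nonneg_of_nonpos_of_nonpos (sub_nonpos.2 (hle k h.le h'.le))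
      (sub_nonpos.2 (hin k h h').le)
  · rw [le_antisymm (hle k h.le le_rfl) (hge k (.inr le_rfl)), sub_self, zero_mul]
  · exact mul_nonneg (sub_nonneg.2 (hge k (.inr h'.le))) (sub_nonneg.2 (hout k (.inr h')))

lemma hasSum_integral_discreteMeasure {w : ℕ → ℝ} (hw : ∀ k, 0 ≤ w k) {φ : ℝ → ℝ}
    (hφ : Integrable φ (discreteMeasure w)) :
    HasSum (fun k : ℕ => w k * φ k) (∫ x, φ x ∂discreteMeasure w) := by
  have h := hasSum_integral_measure hφ
  simpa [integral_smul_measure, ENNReal.toReal_ofReal, hw, discreteMeasure] using h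

/-- Two sequences of nonnegative weights with the same mass and mean, whose ratio `u` is unimodal,
are comparable in the convex order. -/
lemma convexOrder_discreteMeasure_of_unimodal {v w u : ℕ → ℝ} {s μ : ℝ} {N M : ℕ}
    (hw : ∀ k, 0 ≤ w k) (hv : ∀ k, 0 ≤ v k) (hvw : ∀ k, v k = w k * u k)
    (hinc : ∀ k < N, u k ≤ u (k + 1)) (hdec : ∀ k, N ≤ k → u (k + 1) ≤ u k)
    (hM : ∀ k, M < k → u k ≤ 1)
    (hv₀ : HasSum v s) (hw₀ : HasSum w s)
    (hv₁ : HasSum (fun k => v k * k) μ) (hw₁ : HasSum (fun k => w k * k) μ) :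
    ConvexOrder (discreteMeasure v) (discreteMeasure w) := by
  intro φ hφ hiv hiw
  obtain ⟨c, d, h⟩ := hφ.exists_affine_of_unimodal hinc hdec hM
  have hsv := ((hasSum_integral_discreteMeasure hv hiv).sub (hv₀.mul_left c)).sub
    (hv₁.mul_left d)
  have hsw := ((hasSum_integral_discreteMeasure hw hiw).sub (hw₀.mul_left c)).sub
    (hw₁.mul_left d)
  have := hasSum_le (fun k => ?_) hsv hsw
  · linarith
  · rw [hvw]
    linarith [mul_nonneg (hw k) (h k)]

lemma hasSum_poissonPMFReal (θ : ℝ) : HasSum (_root_.poissonPMFReal θ) 1 := by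
  have h := (NormedSpace.expSeries_div_hasSum_exp θ).mul_left (Real.exp (-θ))
  rw [← Real.exp_eq_exp_ℝ, ← Real.exp_add, neg_add_cancel, Real.exp_zero] at h
  refine h.congr_fun fun k => ?_
  exact mul_div_assoc _ _ _

lemma hasSum_poissonPMFReal_mul_natCast (θ : ℝ) :
    HasSum (fun k : ℕ => _root_.poissonPMFReal θ k * k) θ := by
  rw [← hasSum_nat_add_iff' 1]
  have h := (hasSum_poissonPMFReal θ).mul_left θ
  simp only [Finset.sum_range_one, Nat.cast_zero, mul_zero, sub_zero]
  rw [mul_one] at h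
  refine h.congr_fun fun k => ?_
  rw [_root_.poissonPMFReal, _root_.poissonPMFReal, Nat.factorial_succ, pow_succ]
  push_cast
  field_simp

lemma hasSum_binomialPMFReal (m : ℕ) (q : ℝ) : HasSum (binomialPMFReal m q) 1 := by
  have h : ∑ k ∈ Finset.range (m + 1), binomialPMFReal m q k = 1 := by
    have := add_pow q (1 - q) m
    rw [add_sub_cancel, one_pow] at this
    rw [this]
    exact Finset.sum_congr rfl fun k _ => by rw [binomialPMFReal]; ring
  rw [← h]
  refine hasSum_sum_of_ne_finset_zero fun k hk => ?_
  simp [binomialPMFReal, Nat.choose_eq_zero_of_lt (show m < k by simpa using hk)]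

lemma hasSum_binomialPMFReal_mul_natCast {m : ℕ} (hm : 1 ≤ m) (q : ℝ) :
    HasSum (fun k : ℕ => binomialPMFReal m q k * k) (m * q) := by
  obtain ⟨n, rfl⟩ := Nat.exists_eq_add_of_le' hm
  rw [← hasSum_nat_add_iff' 1]
  have h := (hasSum_binomialPMFReal n q).mul_left (((n + 1 : ℕ) : ℝ) * q)
  simp only [Finset.sum_range_one, Nat.cast_zero, mul_zero, sub_zero]
  rw [mul_one] at h
  refine h.congr_fun fun k => ?_
  have hc : ((n + 1).choose (k + 1) : ℝ) * (k + 1 : ℕ) = (n + 1 : ℕ) * n.choose k := by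
    exact_mod_cast (Nat.add_one_mul_choose_eq n k).symm
  simp only [binomialPMFReal, Nat.add_sub_add_right]
  linear_combination q ^ (k + 1) * (1 - q) ^ (n - k) * hc

/-- The binomial distribution is dominated in the convex order by the Poisson distribution with
the same mean. -/
lemma binomialMeasure_convexOrder_poissonMeasure {m : ℕ} (hm : 1 ≤ m) {q : ℝ} (hq₀ : 0 ≤ q)
    (hq₁ : q ≤ 1) : ConvexOrder (binomialMeasure m q) (_root_.poissonMeasure (m * q)) := by
  have hm' : (0 : ℝ) < m := by exact_mod_cast hm
  have hq : 0 ≤ 1 - q := sub_nonneg.2 hq₁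
  set u : ℕ → ℝ := fun k =>
    m.descFactorial k * (1 - q) ^ (m - k) * Real.exp (m * q) / m ^ k with hu
  have hu₀ : ∀ k, 0 ≤ u k := fun k => by positivity
  have hu_zero : ∀ k, m < k → u k = 0 := fun k hk => by
    simp [hu, Nat.descFactorial_eq_zero_iff_lt.2 hk]
  have hrec : ∀ k, u (k + 1) * (m * (1 - q)) = u k * (m - k) := by
    intro k
    rcases lt_trichotomy k m with h | rfl | h
    · obtain ⟨j, rfl⟩ := Nat.exists_eq_add_of_lt h
      have h₁ : k + j + 1 - k = j + 1 := by lia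
      have h₂ : k + j + 1 - (k + 1) = j := by lia
      simp only [hu, Nat.descFactorial_succ, h₁, h₂]
      push_cast at hm' ⊢
      field_simp
      ring
    · simp [hu_zero (k + 1) (Nat.lt_succ_self k)]
    · simp [hu_zero k h, hu_zero (k + 1) (h.trans (Nat.lt_succ_self k))]
  refine convexOrder_discreteMeasure_of_unimodal (u := u) (N := ⌈m * q⌉₊) (M := m)
    (fun k => by unfold _root_.poissonPMFReal; positivity)
    (fun k => by unfold binomialPMFReal; positivity) ?_ ?_ ?_ ?_
    (hasSum_binomialPMFReal m q) (hasSum_poissonPMFReal _)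
    (hasSum_binomialPMFReal_mul_natCast hm q) (hasSum_poissonPMFReal_mul_natCast _)
  · intro k
    have hk : ((k.factorial : ℕ) : ℝ) ≠ 0 := by positivity
    simp only [hu, binomialPMFReal, _root_.poissonPMFReal,
      Nat.descFactorial_eq_factorial_mul_choose, Real.exp_neg, mul_pow, Nat.cast_mul]
    field_simp
  · intro k hk
    rw [Nat.lt_ceil] at hk
    rcases hq.eq_or_lt with h | h
    · have := hrec k
      rw [← h, mul_zero, mul_zero, eq_comm, mul_eq_zero] at this
      rcases this with h' | h'
      · rw [h']; exact hu₀ _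
      · nlinarith
    · refine le_of_mul_le_mul_right ?_ (mul_pos hm' h)
      rw [hrec]
      exact mul_le_mul_of_nonneg_left (by linarith) (hu₀ k)
  · intro k hk
    rw [Nat.ceil_le] at hk
    rcases hq.eq_or_lt with h | h
    · have : m ≤ k := by
        rw [show q = 1 by linarith, mul_one] at hk
        exact_mod_cast hk
      rw [hu_zero (k + 1) (by lia)]
      exact hu₀ k
    · refine le_of_mul_le_mul_right ?_ (mul_pos hm' h)
      rw [hrec]
      exact mul_le_mul_of_nonneg_left (by linarith) (hu₀ k)
  · intro k hk
    rw [hu_zero k hk]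
    exact zero_le_one

lemma ConvexOrder.ziMeasure {p : ℝ} (hp : p < 1) {μ ν : Measure ℝ} (h : ConvexOrder μ ν) :
    ConvexOrder (ziMeasure p μ) (ziMeasure p ν) := by
  intro φ hφ hμ hν
  have hp' : ENNReal.ofReal (1 - p) ≠ 0 := by simpa using hp
  have hμ' := (integrable_smul_measure hp' ENNReal.ofReal_ne_top).1 hμ.right_of_add_measure
  have hν' := (integrable_smul_measure hp' ENNReal.ofReal_ne_top).1 hν.right_of_add_measure
  rw [_root_.ziMeasure, _root_.ziMeasure,
    integral_add_measure hμ.left_of_add_measure hμ.right_of_add_measure,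
    integral_add_measure hν.left_of_add_measure hν.right_of_add_measure,
    integral_smul_measure, integral_smul_measure, integral_smul_measure]
  exact add_le_add le_rfl
    (smul_le_smul_of_nonneg_left (h φ hφ hμ' hν') ENNReal.toReal_nonneg)

/-- For every fixed `0 ≤ p < 1`, every integer `m ≥ 1` and every
`0 < θ ≤ m(1-p)`, the zero-inflated binomial distribution is dominated in the convex order
by the zero-inflated Poisson distribution with the same mean and zero-inflation:
`X(m,θ,p) ≤cx Y(θ,p)`. -/
theorem zib_convexOrder_zip (p : ℝ) (hp₀ : 0 ≤ p) (hp₁ : p < 1)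
    (m : ℕ) (hm : 1 ≤ m) (θ : ℝ) (hθ : 0 < θ) (hθm : θ ≤ m * (1 - p)) :
    ConvexOrder (ZIB m θ p) (ZIP θ p) := by
  have hp : 0 < 1 - p := sub_pos.2 hp₁
  have hm' : (0 : ℝ) < m := by exact_mod_cast hm
  have h := binomialMeasure_convexOrder_poissonMeasure hm (q := θ / (m * (1 - p)))
    (by positivity) ((div_le_one (by positivity)).2 hθm)
  rw [show m * (θ / (m * (1 - p))) = θ / (1 - p) by field_simp] at h
  exact h.ziMeasure hp₁

end
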